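/- Let G be a group, H ≤ G a subgroup of finite index (H.index ≠ 0), σ : Fin k → G with Subgroup.closure (Set.range σ) = ⊤, and τ : Fin l → H with Subgroup.closure (Set.range τ) = ⊤. Then the seeded domino problem SDP(G,σ) is ComputablePred if and only if SDP(H,τ) is ComputablePred. -/

import Mathlib

/-- An instance of the domino problems on a group with a generating family
indexed by `Fin k`. -/
abbrev DomInstance (k : ℕ) : Type := Σ m : ℕ, Finset (Fin m × Fin m × Fin k) × Fin m

instance (k : ℕ) : Infinite (DomInstance k) :=
  Infinite.of_injective (fun n => (⟨n + 1, ∅, 0⟩ : DomInstance k)) fun a b h => by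
    have : a + 1 = b + 1 := congrArg Sigma.fst h
    omega

noncomputable instance (k : ℕ) : Denumerable (DomInstance k) :=
  Denumerable.ofEncodableOfInfinite _

/-- The seeded domino problem on `G` with respect to the generating family `σ`. -/
def SDP (G : Type*) [Group G] {k : ℕ} (σ : Fin k → G) (I : DomInstance k) : Prop :=
  ∃ x : G → Fin I.1,
    (∀ (g : G) (i : Fin k), (x g, x (g * σ i), i) ∉ I.2.1) ∧ x 1 = I.2.2

theorem exists_list_of_encodable {α : Type*} [Encodable α] (F : Finset α) : ∃ l : List α,
    l.Pairwise (fun a b => Encodable.encode a < Encodable.encode b) ∧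
    (∀ a, a ∈ l ↔ a ∈ F) ∧ Encodable.encode F = Encodable.encode l := by
  let r : α → α → Prop := Encodable.encode ⁻¹'o (· ≤ ·)
  have : IsLinearOrder α r :=
    (RelEmbedding.preimage ⟨Encodable.encode, Encodable.encode_injective⟩ (· ≤ ·)).isLinearOrder
  have key : ∃ _ : DecidableRel r, Encodable.encode F = Encodable.encode (F.1.sort r) := ⟨_, rfl⟩
  obtain ⟨_, key⟩ := key
  refine ⟨F.1.sort r, ?_, fun a => Multiset.mem_sort r, key⟩
  have h1 := Multiset.pairwise_sort F.1 r
  have h2 : (F.1.sort r).Nodup := by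
    rw [← Multiset.coe_nodup, Multiset.sort_eq]; exact F.2
  exact h1.imp₂
    (fun a b hab hne => lt_of_le_of_ne hab fun h => hne (Encodable.encode_injective h)) h2

theorem encode_ofEncodableOfInfinite {α : Type*} [E : Encodable α] [Infinite α]
    [DecidablePred fun n => n ∈ Set.range E.encode] (a : α) :
    (Denumerable.ofEncodableOfInfinite α).toEncodable.encode a =
      Nat.count (fun n => n ∈ Set.range E.encode) (E.encode a) := by
  have : (Denumerable.ofEncodableOfInfinite α).toEncodable.encode a =
    @Nat.count (fun n => n ∈ Set.range E.encode)
      (fun n => Encodable.decidableRangeEncode α n) (E.encode a) := rfl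
  convert this

theorem Primrec.nat_count {p : ℕ → Prop} [DecidablePred p] (hp : PrimrecPred p) :
    Primrec (Nat.count p) :=
  (Primrec.list_length.comp ((Primrec.listFilter hp).comp Primrec.list_range)).of_eq fun n => by
    rw [Nat.count, List.countP_eq_length_filter]

theorem computable_encode_ofEncodableOfInfinite {α : Type*} [E : Encodable α] [Infinite α]
    (h : PrimrecPred fun n => n ∈ Set.range E.encode) :
    @Computable α ℕ (@Primcodable.ofDenumerable α (Denumerable.ofEncodableOfInfinite α)) _
      E.encode := by
  classical
  let D := Denumerable.ofEncodableOfInfinite α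
  let P := @Primcodable.ofDenumerable α D
  let p : ℕ → Prop := fun n => n ∈ Set.range E.encode
  let R : α → ℕ → Prop := fun a n => p n ∧ Nat.count p n = D.toEncodable.encode a
  have hR : @ComputablePred (α × ℕ) (@Primcodable.prod α ℕ P _) fun q => R q.1 q.2 :=
    PrimrecPred.computablePred <| (h.comp Primrec.snd).and <|
      Primrec.eq.comp ((Primrec.nat_count h).comp Primrec.snd)
        ((@Primrec.encode α P).comp Primrec.fst)
  have hE : ∀ a, R a (E.encode a) := fun a => ⟨⟨a, rfl⟩, (encode_ofEncodableOfInfinite a).symm⟩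
  refine (@Computable.find α P R _ hR fun a => ⟨_, hE a⟩).of_eq fun a => ?_
  obtain ⟨h1, h2⟩ := Nat.find_spec (⟨_, hE a⟩ : ∃ n, R a n)
  exact Nat.count_injective h1 (hE a).1 (h2.trans (hE a).2.symm)

theorem ComputablePred.and' {α : Type*} [Primcodable α] {p q : α → Prop}
    (hp : ComputablePred p) (hq : ComputablePred q) : ComputablePred fun a => p a ∧ q a := by
  classical
  exact Computable.computablePred
    ((Primrec.and.to_comp.comp hp.decide hq.decide).of_eq fun a => by simp)

theorem Computable.nat_exists_lt {α : Type*} [Primcodable α] {P : α → ℕ → Prop} {f : α → ℕ}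
    (hP : ComputablePred fun q : α × ℕ => P q.1 q.2) (hf : Computable f) :
    ComputablePred fun a => ∃ c < f a, P a c := by
  classical
  have h : Computable fun a => Nat.rec (motive := fun _ => Bool) false
      (fun c b => b || decide (P a c)) (f a) :=
    Computable.nat_rec hf (Computable.const false) <|
      Primrec.or.to_comp.comp (Computable.snd.comp Computable.snd)
        (hP.decide.comp (Computable.fst.pair (Computable.fst.comp Computable.snd))) |>.to₂
  refine Computable.computablePred (h.of_eq fun a => ?_)
  induction f a with
  | zero => simp
  | succ n ih => simp only [ih, Nat.exists_lt_succ_right, Bool.decide_or]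

theorem Primrec.nat_pow : Primrec₂ ((· ^ ·) : ℕ → ℕ → ℕ) :=
  Primrec₂.unpaired'.1 Nat.Primrec.pow

theorem exists_finite_window {Γ G α ι : Type*} [Group Γ] [Group G] (φ : Γ →* G) {τ : ι → Γ}
    (hτ : Subgroup.closure (Set.range τ) = ⊤) (h : Γ) (t : G) :
    ∃ V : Set G, V.Finite ∧ ∀ U, V ⊆ U → ∀ z : Γ → G → α,
      (∀ i h, ∀ u ∈ U, φ (τ i) * u ∈ U → z h (φ (τ i) * u) = z (h * τ i) u) →
        ∀ h₀, z h₀ (φ h * t) = z (h₀ * h) t := by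
  have hh : h ∈ Subgroup.closure (Set.range τ) := hτ ▸ Subgroup.mem_top h
  induction hh using Subgroup.closure_induction_left with
  | one => exact ⟨∅, Set.finite_empty, by simp⟩
  | mul_left x hx y _ ih =>
    obtain ⟨i, rfl⟩ := hx
    obtain ⟨V, hV, ih⟩ := ih
    refine ⟨insert (φ y * t) (insert (φ (τ i) * (φ y * t)) V), (hV.insert _).insert _, ?_⟩
    intro U hU z hz h₀
    simp only [Set.insert_subset_iff] at hU
    rw [map_mul, mul_assoc, hz i h₀ _ hU.1 hU.2.1, ih U hU.2.2 z hz, mul_assoc]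
  | inv_mul_cancel x hx y _ ih =>
    obtain ⟨i, rfl⟩ := hx
    obtain ⟨V, hV, ih⟩ := ih
    refine ⟨insert (φ y * t) (insert ((φ (τ i))⁻¹ * (φ y * t)) V), (hV.insert _).insert _, ?_⟩
    intro U hU z hz h₀
    simp only [Set.insert_subset_iff] at hU
    have := hz i (h₀ * (τ i)⁻¹) _ hU.2.1 (by simpa using hU.1)
    rw [mul_inv_cancel_left, inv_mul_cancel_right] at this
    rw [map_mul, map_inv, mul_assoc, ← this, ih U hU.2.2 z hz, mul_assoc]

theorem exists_coset_decomposition {Γ G : Type*} [Group Γ] [Group G] {φ : Γ →* G}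
    (hφ : Function.Injective φ) (hind : φ.range.index ≠ 0) :
    ∃ (π : G → Γ) (ρ : G → G), (Set.range ρ).Finite ∧ (∀ g, φ (π g) * ρ g = g) ∧
      (∀ h g, π (φ h * g) = h * π g) ∧ (∀ h g, ρ (φ h * g) = ρ g) ∧ π 1 = 1 ∧ ρ 1 = 1 := by
  have : φ.range.FiniteIndex := ⟨hind⟩
  obtain ⟨T, hT, h1⟩ := φ.range.exists_isComplement_right 1
  have hmem : ∀ g, ∃ h, φ h = (hT.equiv g).1 := fun g => (hT.equiv g).1.2
  choose π hπ using hmem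
  have hmul : ∀ h g, hT.equiv (φ h * g) = (⟨φ h, h, rfl⟩ * (hT.equiv g).1, (hT.equiv g).2) :=
    fun h g => hT.equiv_mul_left ⟨φ h, h, rfl⟩ g
  refine ⟨π, fun g => (hT.equiv g).2, ?_, ?_, ?_, ?_, ?_, ?_⟩
  · have : Finite T := hT.finite_right
    exact (Set.toFinite T).subset (by rintro _ ⟨g, rfl⟩; exact (hT.equiv g).2.2)
  · intro g
    rw [hπ]
    exact hT.equiv_fst_mul_equiv_snd g
  · intro h g
    apply hφ
    rw [hπ, hmul, map_mul, hπ]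
    rfl
  · intro h g
    simp only [hmul]
  · apply hφ
    rw [hπ, hT.equiv_one (one_mem _) h1, map_one]
  · simp only [hT.equiv_one (one_mem _) h1]

theorem exists_window {Γ G : Type*} [Group Γ] [Group G] {φ : Γ →* G}
    (hφ : Function.Injective φ) (hind : φ.range.index ≠ 0) {ι κ : Type*} [Finite κ] {τ : ι → Γ}
    (hτ : Subgroup.closure (Set.range τ) = ⊤) (σ : κ → G) :
    ∃ (N : ℕ) (u : Fin N → G) (p₀ : Fin N), u p₀ = 1 ∧ ∀ y : Γ → Fin N → ℕ,
      (∀ i h p q, u p = φ (τ i) * u q → y h p = y (h * τ i) q) →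
        ∃ x : G → ℕ, x 1 = y 1 p₀ ∧ (∀ g, ∃ h p, x g = y h p) ∧
          ∀ g i, ∃ h p q, u q = u p * σ i ∧ x g = y h p ∧ x (g * σ i) = y h q := by
  obtain ⟨π, ρ, hfin, hdec, hπ, hρ, hπ1, hρ1⟩ := exists_coset_decomposition hφ hind
  choose V hV hVU using fun g : G => exists_finite_window (α := ℕ) φ hτ (π g) (ρ g)
  let U : Set G := Set.range ρ ∪ ⋃ t ∈ Set.range ρ, ⋃ i, insert (t * σ i) (V (t * σ i))
  have hU : U.Finite := hfin.union <| hfin.biUnion fun t _ =>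
    Set.finite_iUnion fun i => (hV _).insert _
  obtain ⟨N, u, hu, hrange⟩ : ∃ (N : ℕ) (u : Fin N → G), Function.Injective u ∧
      Set.range u = U := by
    have := hU.to_subtype
    obtain ⟨N, ⟨e⟩⟩ := Finite.exists_equiv_fin U
    exact ⟨N, fun p => e.symm p, Subtype.val_injective.comp e.symm.injective, by
      rw [Set.range_comp' Subtype.val, e.symm.range_eq_univ, Set.image_univ, Subtype.range_coe]⟩
  have hρU : ∀ g, ρ g ∈ Set.range u := fun g => hrange ▸ Or.inl ⟨g, rfl⟩
  have hσU : ∀ g i, insert (ρ g * σ i) (V (ρ g * σ i)) ⊆ Set.range u := fun g i => by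
    rw [hrange]
    exact (Set.subset_iUnion (fun i => insert (ρ g * σ i) (V (ρ g * σ i))) i).trans <|
      (Set.subset_biUnion_of_mem (u := fun t => ⋃ i, insert (t * σ i) (V (t * σ i)))
        (Set.mem_range_self g)).trans Set.subset_union_right
  obtain ⟨p₀, hp₀⟩ := hρU 1
  refine ⟨N, u, p₀, hp₀.trans hρ1, fun y hy => ?_⟩
  let z : Γ → G → ℕ := fun h => Function.extend u (y h) 0
  have hz : ∀ h p, z h (u p) = y h p := fun h p => hu.extend_apply _ _ p
  refine ⟨fun g => z (π g) (ρ g), ?_, fun g => ?_, fun g i => ?_⟩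
  · dsimp only
    rw [hπ1, ← hp₀, hz]
  · obtain ⟨p, hp⟩ := hρU g
    exact ⟨π g, p, by simp only [← hp, hz]⟩
  · obtain ⟨p, hp⟩ := hρU g
    obtain ⟨q, hq⟩ := hσU g i (Set.mem_insert _ _)
    refine ⟨π g, p, q, by rw [hp, hq], by simp only [← hp, hz], ?_⟩
    have key := hVU (ρ g * σ i) (Set.range u) ((Set.subset_insert _ _).trans (hσU g i)) z
      (by
        rintro j h _ ⟨q, rfl⟩ ⟨p, hp⟩
        rw [← hp, hz, hz]
        exact hy j h p q hp) (π g)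
    rw [hdec, ← hq, hz] at key
    rw [key, hq, ← hπ, ← hρ (π g) (ρ g * σ i), ← mul_assoc, hdec]

/-- Alphabet size, list of forbidden patterns and seed of a domino instance, as plain numbers. -/
abbrev RawInstance : Type := ℕ × List (ℕ × ℕ × ℕ) × ℕ

namespace RawInstance

/-- The raw data is that of the given domino instance, up to patterns that are out of range. -/
def Represents {k : ℕ} (r : RawInstance) (I : DomInstance k) : Prop :=
  r.1 = I.1 ∧ (∀ (a b : Fin I.1) (i : Fin k), (a.1, b.1, i.1) ∈ r.2.1 ↔ (a, b, i) ∈ I.2.1) ∧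
    r.2.2 = I.2.2

/-- The raw data is in range, and its patterns are listed in increasing order of their codes. -/
def IsNormal (k : ℕ) (r : RawInstance) : Prop :=
  r.2.2 < r.1 ∧ (∀ t ∈ r.2.1, t.1 < r.1 ∧ t.2.1 < r.1 ∧ t.2.2 < k) ∧
    r.2.1.Pairwise fun s t => Encodable.encode s < Encodable.encode t

theorem primrecPred_pairwise_encode_lt {α : Type*} [Primcodable α] :
    PrimrecPred fun l : List α =>
      l.Pairwise fun s t => Encodable.encode s < Encodable.encode t := by
  have h1 : PrimrecRel fun (i : ℕ) (q : ℕ × List ℕ) => q.2.getD i 0 < q.2.getD q.1 0 :=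
    Primrec.nat_lt.comp
      ((Primrec.list_getD 0).comp (Primrec.snd.comp Primrec.snd) Primrec.fst)
      ((Primrec.list_getD 0).comp (Primrec.snd.comp Primrec.snd) (Primrec.fst.comp Primrec.snd))
  have h2 : PrimrecRel fun (j : ℕ) (l : List ℕ) => ∀ i ∈ List.range j, l.getD i 0 < l.getD j 0 :=
    h1.forall_mem_list.comp (Primrec.list_range.comp Primrec.fst) Primrec.id
  have h3 : PrimrecPred fun l : List ℕ =>
      ∀ j ∈ List.range l.length, ∀ i ∈ List.range j, l.getD i 0 < l.getD j 0 :=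
    h2.forall_mem_list.comp (Primrec.list_range.comp Primrec.list_length) Primrec.id
  have h4 : PrimrecPred fun l : List ℕ => l.Pairwise (· < ·) := h3.of_eq fun l => by
    simp only [List.mem_range, List.pairwise_iff_getElem]
    constructor
    · intro h i j hi hj hij
      simpa [hi, hj] using h j hj i hij
    · intro h j hj i hij
      simpa [hij.trans hj, hj] using h i j (hij.trans hj) hj hij
  exact (h4.comp (Primrec.list_map Primrec.id (Primrec.encode.comp Primrec.snd).to₂)).of_eq
    fun l => List.pairwise_map

theorem primrecPred_isNormal (k : ℕ) : PrimrecPred (IsNormal k) := by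
  have h1 : PrimrecRel fun (t : ℕ × ℕ × ℕ) (m : ℕ) => t.1 < m ∧ t.2.1 < m ∧ t.2.2 < k :=
    (Primrec.nat_lt.comp (Primrec.fst.comp Primrec.fst) Primrec.snd).and <|
      (Primrec.nat_lt.comp (Primrec.fst.comp (Primrec.snd.comp Primrec.fst)) Primrec.snd).and <|
        Primrec.nat_lt.comp (Primrec.snd.comp (Primrec.snd.comp Primrec.fst)) (Primrec.const k)
  exact (Primrec.nat_lt.comp (Primrec.snd.comp Primrec.snd) Primrec.fst).and <|
    (h1.forall_mem_list.comp (Primrec.fst.comp Primrec.snd) Primrec.fst).and <|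
      primrecPred_pairwise_encode_lt.comp (Primrec.fst.comp Primrec.snd)

/-- The encoding of domino instances from which their denumeration is derived. -/
abbrev sigmaEncodable (k : ℕ) : Encodable (DomInstance k) := Sigma.encodable

theorem encode_map_of_encode_eq {α β : Type*} [Encodable α] [Encodable β] {f : α → β}
    (hf : ∀ a, Encodable.encode (f a) = Encodable.encode a) (l : List α) :
    Encodable.encode (l.map f) = Encodable.encode l := by
  induction l with
  | nil => rfl
  | cons a l ih => simp [Encodable.encode_list_cons, hf, ih]

/-- The numbers underlying a pattern. -/
def patternVal {m k : ℕ} (t : Fin m × Fin m × Fin k) : ℕ × ℕ × ℕ := (t.1, t.2.1, t.2.2)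

theorem encode_patternVal {m k : ℕ} (t : Fin m × Fin m × Fin k) :
    Encodable.encode (patternVal t) = Encodable.encode t := rfl

theorem exists_isNormal_represents {k : ℕ} (I : DomInstance k) :
    ∃ r : RawInstance, r.IsNormal k ∧ r.Represents I ∧
      (sigmaEncodable k).encode I = Encodable.encode r := by
  obtain ⟨m, F, a⟩ := I
  obtain ⟨l, hl, hF, he⟩ := exists_list_of_encodable F
  refine ⟨(m, l.map patternVal, a), ⟨a.2, ?_, ?_⟩, ⟨rfl, ?_, rfl⟩, ?_⟩
  · simp only [List.mem_map]
    rintro _ ⟨t, -, rfl⟩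
    exact ⟨t.1.2, t.2.1.2, t.2.2.2⟩
  · rw [List.pairwise_map]
    exact hl
  · intro b c i
    simp [patternVal, ← hF, Fin.val_inj]
  · change Nat.pair m (Nat.pair (Encodable.encode F) a) =
      Nat.pair m (Nat.pair (Encodable.encode (l.map patternVal)) a)
    rw [he, encode_map_of_encode_eq encode_patternVal]

theorem IsNormal.exists_encode_eq {k : ℕ} {r : RawInstance} (hr : r.IsNormal k) :
    ∃ I : DomInstance k, (sigmaEncodable k).encode I = Encodable.encode r := by
  obtain ⟨m, L, a⟩ := r
  obtain ⟨ha, hb, hs⟩ := hr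
  dsimp only at ha hb hs
  have hL : ∃ l : List (Fin m × Fin m × Fin k), l.map patternVal = L := by
    refine ⟨L.pmap (fun t ht => (⟨t.1, ht.1⟩, ⟨t.2.1, ht.2.1⟩, ⟨t.2.2, ht.2.2⟩)) hb, ?_⟩
    simp [List.map_pmap, patternVal]
  obtain ⟨l, rfl⟩ := hL
  rw [List.pairwise_map] at hs
  obtain ⟨l', hl', hF, he⟩ := exists_list_of_encodable l.toFinset
  refine ⟨⟨m, l.toFinset, ⟨a, ha⟩⟩, ?_⟩
  change Nat.pair m (Nat.pair (Encodable.encode l.toFinset) a) =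
      Nat.pair m (Nat.pair (Encodable.encode (l.map patternVal)) a)
  have hne : ∀ {x : List (Fin m × Fin m × Fin k)},
      (x.Pairwise fun s t => Encodable.encode s < Encodable.encode t) → x.Nodup := fun hx =>
    hx.imp fun h e => h.ne (congrArg _ e)
  have : l' = l := List.Perm.eq_of_pairwise (fun a b _ _ h h' => (h.asymm h').elim) hl' hs <|
    (List.perm_ext_iff_of_nodup (hne hl') (hne hs)).2 (by simpa using hF)
  rw [he, this, encode_map_of_encode_eq encode_patternVal]

theorem primrecPred_range_encode (k : ℕ) :
    PrimrecPred fun n => n ∈ Set.range (sigmaEncodable k).encode := by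
  refine ((primrecPred_isNormal k).comp (Primrec.ofNat RawInstance)).of_eq fun n => ?_
  constructor
  · intro h
    obtain ⟨I, hI⟩ := h.exists_encode_eq
    exact ⟨I, by rw [hI, Denumerable.encode_ofNat]⟩
  · rintro ⟨I, rfl⟩
    obtain ⟨r, hr, -, he⟩ := exists_isNormal_represents I
    rwa [he, Denumerable.ofNat_encode]

theorem exists_computable_represents (k : ℕ) :
    ∃ f : DomInstance k → RawInstance, Computable f ∧ ∀ I, (f I).Represents I := by
  refine ⟨fun I => Denumerable.ofNat RawInstance ((sigmaEncodable k).encode I),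
    (Computable.ofNat _).comp
      (computable_encode_ofEncodableOfInfinite (E := sigmaEncodable k)
        (primrecPred_range_encode k)), fun I => ?_⟩
  obtain ⟨r, -, hr, he⟩ := exists_isNormal_represents I
  simpa only [he, Denumerable.ofNat_encode] using hr

/-- The forbidden patterns of `r` that are in range are forbidden patterns of `s`. -/
def PatternsLE (k : ℕ) (r s : RawInstance) : Prop :=
  ∀ t ∈ r.2.1, t.1 < r.1 ∧ t.2.1 < r.1 ∧ t.2.2 < k → t ∈ s.2.1

theorem primrecRel_mem_list {α : Type*} [Primcodable α] :
    PrimrecRel fun (a : α) (l : List α) => a ∈ l :=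
  ((Primrec.eq (α := α)).exists_mem_list.comp Primrec.snd Primrec.fst).of_eq (by simp)

theorem primrecRel_patternsLE (k : ℕ) : PrimrecRel (PatternsLE k) := by
  have h1 : PrimrecRel fun (t : ℕ × ℕ × ℕ) (q : RawInstance × RawInstance) =>
      ¬(t.1 < q.1.1 ∧ t.2.1 < q.1.1 ∧ t.2.2 < k) ∨ t ∈ q.2.2.1 := by
    have hm : Primrec fun x : (ℕ × ℕ × ℕ) × RawInstance × RawInstance => x.2.1.1 :=
      Primrec.fst.comp (Primrec.fst.comp Primrec.snd)
    exact ((Primrec.nat_lt.comp (Primrec.fst.comp Primrec.fst) hm).and <|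
      (Primrec.nat_lt.comp (Primrec.fst.comp (Primrec.snd.comp Primrec.fst)) hm).and <|
        Primrec.nat_lt.comp (Primrec.snd.comp (Primrec.snd.comp Primrec.fst))
          (Primrec.const k)).not.or <|
      primrecRel_mem_list.comp Primrec.fst
        (Primrec.fst.comp (Primrec.snd.comp (Primrec.snd.comp Primrec.snd)))
  exact (h1.forall_mem_list.comp (Primrec.fst.comp (Primrec.snd.comp Primrec.fst))
    Primrec.id).of_eq fun q => by simp [PatternsLE, imp_iff_not_or]

theorem exists_represents {k : ℕ} {r : RawInstance} (hr : r.2.2 < r.1) :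
    ∃ I : DomInstance k, r.Represents I := by
  classical
  refine ⟨⟨r.1, Finset.univ.filter fun t => patternVal t ∈ r.2.1, ⟨r.2.2, hr⟩⟩, rfl, ?_, rfl⟩
  exact fun a b i => (Finset.mem_filter_univ
    (p := fun t : Fin r.1 × Fin r.1 × Fin k => patternVal t ∈ r.2.1) (a, b, i)).symm

theorem Represents.patternsLE {k : ℕ} {r s : RawInstance} {I : DomInstance k}
    (hr : r.Represents I) (hs : s.Represents I) : r.PatternsLE k s := by
  rintro ⟨a, b, i⟩ ht ⟨ha, hb, hi⟩
  dsimp only at ha hb hi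
  have h := hr.1
  exact (hs.2.1 ⟨a, h ▸ ha⟩ ⟨b, h ▸ hb⟩ ⟨i, hi⟩).2 <|
    (hr.2.1 ⟨a, h ▸ ha⟩ ⟨b, h ▸ hb⟩ ⟨i, hi⟩).1 ht

theorem Represents.of_patternsLE {k : ℕ} {r s : RawInstance} {I : DomInstance k}
    (hs : s.Represents I) (h1 : r.1 = s.1) (h2 : r.2.2 = s.2.2) (hrs : r.PatternsLE k s)
    (hsr : s.PatternsLE k r) : r.Represents I := by
  have h := hs.1
  refine ⟨h1.trans h, fun a b i => ?_, h2.trans hs.2.2⟩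
  rw [← hs.2.1]
  exact ⟨fun ht => hrs _ ht ⟨by simp [h1, h], by simp [h1, h], i.2⟩,
    fun ht => hsr _ ht ⟨by simp [h], by simp [h], i.2⟩⟩

theorem exists_computable_represents_of_lt (k : ℕ) :
    ∃ f : RawInstance → DomInstance k, Computable f ∧
      ∀ r : RawInstance, r.2.2 < r.1 → r.Represents (f r) := by
  classical
  obtain ⟨f, hf, hfr⟩ := exists_computable_represents k
  let R : RawInstance → RawInstance → Prop := fun r s =>
    r.1 ≤ r.2.2 ∨ (r.1 = s.1 ∧ r.2.2 = s.2.2 ∧ r.PatternsLE k s ∧ s.PatternsLE k r)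
  have hR : PrimrecRel R := by
    have hfst : Primrec fun r : RawInstance => r.1 := Primrec.fst
    have hseed : Primrec fun r : RawInstance => r.2.2 := Primrec.snd.comp Primrec.snd
    exact (Primrec.nat_le.comp (hfst.comp Primrec.fst) (hseed.comp Primrec.fst)).or <|
      (Primrec.eq.comp (hfst.comp Primrec.fst) (hfst.comp Primrec.snd)).and <|
      (Primrec.eq.comp (hseed.comp Primrec.fst) (hseed.comp Primrec.snd)).and <|
      (primrecRel_patternsLE k).and (primrecRel_patternsLE k).swap
  have hex : ∀ r, ∃ n, R r (f (Denumerable.ofNat _ n)) := by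
    intro r
    by_cases hr : r.2.2 < r.1
    · obtain ⟨I, hI⟩ := exists_represents (k := k) hr
      obtain ⟨n, rfl⟩ : ∃ n, Denumerable.ofNat (DomInstance k) n = I :=
        ⟨_, Denumerable.ofNat_encode I⟩
      refine ⟨n, Or.inr ?_⟩
      exact ⟨hI.1.trans (hfr _).1.symm, hI.2.2.trans (hfr _).2.2.symm,
        hI.patternsLE (hfr _), (hfr _).patternsLE hI⟩
    · exact ⟨0, Or.inl (not_lt.1 hr)⟩
  have hcomp : ComputablePred fun q : RawInstance × ℕ => R q.1 (f (Denumerable.ofNat _ q.2)) :=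
    ComputablePred.computable_of_manyOneReducible
      ⟨fun q => (q.1, f (Denumerable.ofNat _ q.2)),
        Computable.fst.pair (hf.comp ((Computable.ofNat _).comp Computable.snd)),
        fun q => Iff.rfl⟩ (PrimrecPred.computablePred hR)
  refine ⟨fun r => Denumerable.ofNat _ (Nat.find (hex r)),
    (Computable.ofNat _).comp (Computable.find hcomp hex), fun r hr => ?_⟩
  obtain h | ⟨h1, h2, h3, h4⟩ := Nat.find_spec (hex r)
  · exact absurd hr (not_lt.2 h)
  · exact (hfr _).of_patternsLE h1 h2 h3 h4

/-- The seeded domino problem for raw data. -/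
def Solvable {G : Type*} [Group G] {k : ℕ} (σ : Fin k → G) (r : RawInstance) : Prop :=
  ∃ x : G → ℕ, (∀ g, x g < r.1) ∧ (∀ (g : G) (i : Fin k), (x g, x (g * σ i), i.1) ∉ r.2.1) ∧
    x 1 = r.2.2

section

variable {G : Type*} [Group G] {k : ℕ} {σ : Fin k → G}

theorem Represents.solvable_iff {r : RawInstance} {I : DomInstance k} (h : r.Represents I) :
    r.Solvable σ ↔ SDP G σ I := by
  obtain ⟨h1, h2, h3⟩ := h
  constructor
  · rintro ⟨x, hx, hF, h⟩
    refine ⟨fun g => ⟨x g, h1 ▸ hx g⟩, fun g i => ?_, Fin.ext (h.trans h3)⟩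
    rw [← h2]
    exact hF g i
  · rintro ⟨x, hF, h⟩
    exact ⟨fun g => x g, fun g => by simp [h1], fun g i => by rw [h2]; exact hF g i,
      (congrArg Fin.val h).trans h3.symm⟩

theorem Solvable.seed_lt {r : RawInstance} (h : r.Solvable σ) : r.2.2 < r.1 := by
  obtain ⟨x, hx, -, h⟩ := h
  exact h ▸ hx 1

theorem computablePred_solvable_iff :
    ComputablePred (Solvable σ) ↔ ComputablePred (SDP G σ) := by
  constructor
  · intro h
    obtain ⟨f, hf, hfr⟩ := exists_computable_represents k
    exact ComputablePred.computable_of_manyOneReducible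
      ⟨f, hf, fun I => (hfr I).solvable_iff.symm⟩ h
  · intro h
    obtain ⟨f, hf, hfr⟩ := exists_computable_represents_of_lt k
    have hlt : ComputablePred fun r : RawInstance => r.2.2 < r.1 :=
      PrimrecPred.computablePred <|
        Primrec.nat_lt.comp (Primrec.snd.comp Primrec.snd) Primrec.fst
    refine (hlt.and' (ComputablePred.computable_of_manyOneReducible
      ⟨f, hf, fun I => Iff.rfl⟩ h)).of_eq fun r => ?_
    exact ⟨fun hr => (hfr r hr.1).solvable_iff.2 hr.2,
      fun hr => ⟨hr.seed_lt, (hfr r hr.seed_lt).solvable_iff.1 hr⟩⟩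

end

/-- The digit of `c` in base `m` at place `p`. -/
def digit (m p c : ℕ) : ℕ := c / m ^ p % m

theorem exists_digit_eq {m N : ℕ} {f : Fin N → ℕ} (hf : ∀ p, f p < m) :
    ∃ c < m ^ N, ∀ p : Fin N, digit m p c = f p := by
  refine ⟨finFunctionFinEquiv fun p => ⟨f p, hf p⟩, Fin.is_lt _, fun p => ?_⟩
  exact congrArg Fin.val (congrFun (finFunctionFinEquiv.symm_apply_apply fun p => ⟨f p, hf p⟩) p)

theorem primrec_digit {α : Type*} [Primcodable α] {f g h : α → ℕ} (hf : Primrec f)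
    (hg : Primrec g) (hh : Primrec h) : Primrec fun a => digit (f a) (g a) (h a) :=
  Primrec.nat_mod.comp (Primrec.nat_div.comp hh (Primrec.nat_pow.comp hf hg)) hf

/-- The tuple of letters coded by `c` contains none of the forbidden patterns of `r` at the
places listed in `E`. -/
def Good (E : List (ℕ × ℕ × ℕ)) (r : RawInstance) (c : ℕ) : Prop :=
  ∀ e ∈ E, (digit r.1 e.1 c, digit r.1 e.2.1 c, e.2.2) ∉ r.2.1

/-- The tuples of letters coded by `t.1` and `t.2.1` agree where `D` prescribes this for
the generator `t.2.2`. -/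
def Compatible (D : List (ℕ × ℕ × ℕ)) (m : ℕ) (t : ℕ × ℕ × ℕ) : Prop :=
  ∀ e ∈ D, e.2.2 = t.2.2 → digit m e.1 t.1 = digit m e.2.1 t.2.1

/-- The pairs of tuples that are allowed in the higher block presentation of `r`. -/
def Allowed (D E : List (ℕ × ℕ × ℕ)) (t : ℕ × ℕ × ℕ) (r : RawInstance) : Prop :=
  r.Good E t.1 ∧ r.Good E t.2.1 ∧ Compatible D r.1 t

theorem primrecRel_good (E : List (ℕ × ℕ × ℕ)) : PrimrecRel (Good E) := by
  have h : PrimrecRel fun (e : ℕ × ℕ × ℕ) (q : RawInstance × ℕ) =>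
      (digit q.1.1 e.1 q.2, digit q.1.1 e.2.1 q.2, e.2.2) ∉ q.1.2.1 := by
    have hm : Primrec fun x : (ℕ × ℕ × ℕ) × RawInstance × ℕ => x.2.1.1 :=
      Primrec.fst.comp (Primrec.fst.comp Primrec.snd)
    have hc : Primrec fun x : (ℕ × ℕ × ℕ) × RawInstance × ℕ => x.2.2 :=
      Primrec.snd.comp Primrec.snd
    have he : Primrec fun x : (ℕ × ℕ × ℕ) × RawInstance × ℕ => x.1.2 :=
      Primrec.snd.comp Primrec.fst
    have hL : Primrec fun x : (ℕ × ℕ × ℕ) × RawInstance × ℕ => x.2.1.2.1 :=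
      Primrec.fst.comp (Primrec.snd.comp (Primrec.fst.comp Primrec.snd))
    exact (primrecRel_mem_list.comp ((primrec_digit hm (Primrec.fst.comp Primrec.fst) hc).pair
      ((primrec_digit hm (Primrec.fst.comp he) hc).pair (Primrec.snd.comp he))) hL).not
  exact h.forall_mem_list.comp (Primrec.const E) Primrec.id

theorem primrecRel_compatible (D : List (ℕ × ℕ × ℕ)) : PrimrecRel (Compatible D) := by
  have h : PrimrecRel fun (e : ℕ × ℕ × ℕ) (q : ℕ × ℕ × ℕ × ℕ) =>
      ¬e.2.2 = q.2.2.2 ∨ digit q.1 e.1 q.2.1 = digit q.1 e.2.1 q.2.2.1 := by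
    have hm : Primrec fun x : (ℕ × ℕ × ℕ) × ℕ × ℕ × ℕ × ℕ => x.2.1 :=
      Primrec.fst.comp Primrec.snd
    have ht : Primrec fun x : (ℕ × ℕ × ℕ) × ℕ × ℕ × ℕ × ℕ => x.2.2 :=
      Primrec.snd.comp Primrec.snd
    have he : Primrec fun x : (ℕ × ℕ × ℕ) × ℕ × ℕ × ℕ × ℕ => x.1.2 :=
      Primrec.snd.comp Primrec.fst
    exact (Primrec.eq.comp (Primrec.snd.comp he) (Primrec.snd.comp (Primrec.snd.comp ht))).not.or
      (Primrec.eq.comp (primrec_digit hm (Primrec.fst.comp Primrec.fst) (Primrec.fst.comp ht))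
        (primrec_digit hm (Primrec.fst.comp he) (Primrec.fst.comp (Primrec.snd.comp ht))))
  exact (h.forall_mem_list.comp (Primrec.const D) Primrec.id).of_eq fun q => by
    simp [Compatible, imp_iff_not_or]

theorem primrecRel_allowed (D E : List (ℕ × ℕ × ℕ)) : PrimrecRel (Allowed D E) :=
  ((primrecRel_good E).comp Primrec.snd (Primrec.fst.comp Primrec.fst)).and <|
    ((primrecRel_good E).comp Primrec.snd
      (Primrec.fst.comp (Primrec.snd.comp Primrec.fst))).and <|
    (primrecRel_compatible D).comp (Primrec.fst.comp Primrec.snd) Primrec.fst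

/-- All triples with the first two entries below `n` and the third one below `l`. -/
def triples (l n : ℕ) : List (ℕ × ℕ × ℕ) :=
  (List.range n).flatMap fun b => (List.range n).flatMap fun c =>
    (List.range l).map fun i => (b, c, i)

theorem mem_triples {l n : ℕ} {t : ℕ × ℕ × ℕ} :
    t ∈ triples l n ↔ t.1 < n ∧ t.2.1 < n ∧ t.2.2 < l := by
  obtain ⟨a, b, i⟩ := t
  simp [triples]

theorem primrec_triples (l : ℕ) : Primrec (triples l) :=
  Primrec.list_flatMap Primrec.list_range <|
    Primrec.list_flatMap (Primrec.list_range.comp Primrec.fst) <|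
      Primrec.list_map (Primrec.const (List.range l)) <|
        (Primrec.snd.comp (Primrec.fst.comp Primrec.fst)).pair
          ((Primrec.snd.comp Primrec.fst).pair Primrec.snd)

open Classical in
/-- The higher block presentation of `r` with seed `c`. -/
noncomputable def higherBlock (N l : ℕ) (D E : List (ℕ × ℕ × ℕ)) (r : RawInstance) (c : ℕ) :
    RawInstance :=
  (r.1 ^ N, (triples l (r.1 ^ N)).filter fun t => ¬Allowed D E t r, c)

theorem primrec_higherBlock (N l : ℕ) (D E : List (ℕ × ℕ × ℕ)) :
    Primrec₂ (higherBlock N l D E) := by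
  classical
  have hm : Primrec fun q : RawInstance × ℕ => q.1.1 ^ N :=
    Primrec.nat_pow.comp (Primrec.fst.comp Primrec.fst) (Primrec.const N)
  have h := (primrecRel_allowed D E).not.listFilter.comp ((primrec_triples l).comp hm) Primrec.fst
  refine (hm.pair (h.pair Primrec.snd)).of_eq fun q => ?_
  simp only [higherBlock]

theorem solvable_higherBlock_iff {Γ : Type*} [Group Γ] {l N : ℕ} {τ : Fin l → Γ}
    {D E : List (ℕ × ℕ × ℕ)} {r : RawInstance} {c : ℕ} :
    (r.higherBlock N l D E c).Solvable τ ↔ ∃ z : Γ → ℕ, (∀ h, z h < r.1 ^ N) ∧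
      (∀ h (i : Fin l), Allowed D E (z h, z (h * τ i), i) r) ∧ z 1 = c := by
  refine exists_congr fun z => and_congr_right fun hz => and_congr_left' ?_
  refine forall_congr' fun h => forall_congr' fun i => ?_
  have hz' : ∀ g, z g < r.1 ^ N := hz
  simp [higherBlock, List.mem_filter, mem_triples, hz']

theorem good_of_allowed {Γ : Type*} [Group Γ] {l : ℕ} {τ : Fin l → Γ}
    (hτ : Subgroup.closure (Set.range τ) = ⊤) {D E : List (ℕ × ℕ × ℕ)} {r : RawInstance}
    {z : Γ → ℕ} (hz : ∀ h (i : Fin l), Allowed D E (z h, z (h * τ i), i) r)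
    (h1 : r.Good E (z 1)) (h : Γ) : r.Good E (z h) := by
  have hh : h ∈ Subgroup.closure (Set.range τ) := hτ ▸ Subgroup.mem_top h
  induction hh using Subgroup.closure_induction_right with
  | one => exact h1
  | mul_right x _ y hy _ =>
    obtain ⟨i, rfl⟩ := hy
    exact (hz x i).2.1
  | mul_inv_cancel x _ y hy _ =>
    obtain ⟨i, rfl⟩ := hy
    simpa using (hz (x * (τ i)⁻¹) i).1

theorem computablePred_solvable_of_finiteIndex {Γ G : Type*} [Group Γ] [Group G] {φ : Γ →* G}
    (hφ : Function.Injective φ) (hind : φ.range.index ≠ 0) {k l : ℕ} {τ : Fin l → Γ}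
    (hτ : Subgroup.closure (Set.range τ) = ⊤) (σ : Fin k → G)
    (h : ComputablePred (Solvable τ)) : ComputablePred (Solvable σ) := by
  classical
  obtain ⟨N, u, p₀, hp₀, hu⟩ := exists_window hφ hind hτ σ
  obtain ⟨D, hD⟩ : ∃ D : List (ℕ × ℕ × ℕ), ∀ t, t ∈ D ↔
      ∃ (p q : Fin N) (i : Fin l), u p = φ (τ i) * u q ∧ (p.1, q.1, i.1) = t :=
    ⟨((Finset.univ.filter fun t : Fin N × Fin N × Fin l =>
      u t.1 = φ (τ t.2.2) * u t.2.1).image patternVal).toList, by simp [patternVal]⟩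
  obtain ⟨E, hE⟩ : ∃ E : List (ℕ × ℕ × ℕ), ∀ t, t ∈ E ↔
      ∃ (p q : Fin N) (i : Fin k), u q = u p * σ i ∧ (p.1, q.1, i.1) = t :=
    ⟨((Finset.univ.filter fun t : Fin N × Fin N × Fin k =>
      u t.2.1 = u t.1 * σ t.2.2).image patternVal).toList, by simp [patternVal]⟩
  have key : ∀ r : RawInstance, r.Solvable σ ↔ ∃ c < r.1 ^ N,
      (digit r.1 p₀ c = r.2.2 ∧ r.Good E c) ∧ (r.higherBlock N l D E c).Solvable τ := by
    intro r
    simp only [solvable_higherBlock_iff]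
    constructor
    · rintro ⟨x, hx, hF, h1⟩
      choose z hz hzd using fun h => exists_digit_eq fun p : Fin N => hx (φ h * u p)
      have hgood : ∀ h, r.Good E (z h) := by
        intro h t ht
        obtain ⟨p, q, i, hpq, rfl⟩ := (hE t).1 ht
        simp only [hzd, hpq, ← mul_assoc]
        exact hF _ i
      refine ⟨z 1, hz 1, ⟨by rw [hzd, hp₀, map_one, one_mul, h1], hgood 1⟩, z, hz, ?_, rfl⟩
      refine fun h i => ⟨hgood _, hgood _, fun t ht hi => ?_⟩
      obtain ⟨p, q, j, hpq, rfl⟩ := (hD t).1 ht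
      obtain rfl : j = i := Fin.ext hi
      simp only [hzd, hpq, map_mul, mul_assoc]
    · rintro ⟨c, hc, ⟨hseed, hgood⟩, z, hz, hF, rfl⟩
      have hm : 0 < r.1 := by
        refine Nat.pos_of_ne_zero fun h0 => ?_
        rw [h0, zero_pow p₀.pos.ne'] at hc
        exact Nat.not_lt_zero _ hc
      obtain ⟨x, hx1, hxlt, hx⟩ := hu (fun h p => digit r.1 p (z h)) fun i h p q hpq =>
        (hF h i).2.2 (p, q, i) ((hD _).2 ⟨p, q, i, hpq, rfl⟩) rfl
      refine ⟨x, fun g => ?_, fun g i => ?_, hx1.trans hseed⟩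
      · obtain ⟨h, p, hp⟩ := hxlt g
        exact hp ▸ Nat.mod_lt _ hm
      · obtain ⟨h, p, q, hpq, hp, hq⟩ := hx g i
        rw [hp, hq]
        exact good_of_allowed hτ hF hgood h (p, q, i) ((hE _).2 ⟨p, q, i, hpq, rfl⟩)
  refine ComputablePred.of_eq (Computable.nat_exists_lt ?_ ?_) fun r => (key r).symm
  · refine ComputablePred.and' (PrimrecPred.computablePred ?_)
      (ComputablePred.computable_of_manyOneReducible
        ⟨_, (primrec_higherBlock N l D E).to_comp, fun _ => Iff.rfl⟩ h)
    exact (Primrec.eq.comp (primrec_digit (Primrec.fst.comp Primrec.fst) (Primrec.const p₀.1)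
      Primrec.snd) (Primrec.snd.comp (Primrec.snd.comp Primrec.fst))).and (primrecRel_good E)
  · exact (Primrec.nat_pow.comp Primrec.fst (Primrec.const N)).to_comp

theorem solvable_coe_iff {G : Type*} [Group G] {H : Subgroup G} {l : ℕ} (τ : Fin l → H)
    (r : RawInstance) : Solvable (fun i => (τ i : G)) r ↔ Solvable τ r := by
  constructor
  · rintro ⟨x, hx, hF, h1⟩
    exact ⟨fun h => x h, fun h => hx h, fun h i => hF h i, h1⟩
  · rintro ⟨x, hx, hF, h1⟩
    obtain ⟨T, hT, hT1⟩ := H.exists_isComplement_left 1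
    refine ⟨fun g => x (hT.equiv g).2, fun g => hx _, fun g i => ?_, ?_⟩
    · simp only [hT.equiv_mul_right]
      exact hF _ i
    · dsimp only
      rw [hT.equiv_one hT1 (one_mem _)]
      exact h1

end RawInstance

/-- The seeded domino problem on a group is decidable iff it is decidable on a
finite-index subgroup. -/
theorem sdp_computablePred_iff_finiteIndex {G : Type*} [Group G]
    (H : Subgroup G) (hind : H.index ≠ 0) {k l : ℕ}
    (σ : Fin k → G) (τ : Fin l → H)
    (hσ : Subgroup.closure (Set.range σ) = ⊤)
    (hτ : Subgroup.closure (Set.range τ) = ⊤) :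
    ComputablePred (SDP G σ) ↔ ComputablePred (SDP H τ) := by
  rw [← RawInstance.computablePred_solvable_iff, ← RawInstance.computablePred_solvable_iff]
  constructor
  · intro h
    refine (RawInstance.computablePred_solvable_of_finiteIndex (φ := MonoidHom.id G)
      Function.injective_id ?_ hσ (fun i => (τ i : G)) h).of_eq (RawInstance.solvable_coe_iff τ)
    simp [MonoidHom.range_eq_top_of_surjective (MonoidHom.id G) Function.surjective_id]
  · refine RawInstance.computablePred_solvable_of_finiteIndex (φ := H.subtype)
      Subtype.val_injective ?_ hτ σ
    rwa [H.range_subtype]
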